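/- For every η>0 there exists R_η>0 such that for every optimal trajectory on [0,T] steering X₀=(0,0,π/2,0) to X₁=(x₁,y₁,θ₁,0) with |(x₁,y₁)| ≥ R_η, equipped with PMP adjoint data (ρ, φ̂, p₃, p₄), one has |φ̂−α| ≤ η and ρ ≤ 1+η, where (x₁,y₁)=|(x₁,y₁)|(cos α, sin α) with α ∈ [0,2π) and the angle difference |φ̂−α| is taken modulo 2π with values in [0,π]. -/

import Mathlib

open MeasureTheory Real Set

noncomputable section

/-- Distance between two angles, computed modulo `2π`, with values in `[0, π]`. -/
def angleDist (a b : ℝ) : ℝ := ‖((a - b : ℝ) : Real.Angle)‖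

/-- Hypothesis (H1): `φ` and `ψ` are nonnegative, `C²`, even, nondecreasing on `[0,∞)`,
and vanish at `0`. -/
def H1 (φ ψ : ℝ → ℝ) : Prop :=
  (∀ r, 0 ≤ φ r) ∧ (∀ r, 0 ≤ ψ r) ∧
  ContDiff ℝ 2 φ ∧ ContDiff ℝ 2 ψ ∧
  (∀ r, φ (-r) = φ r) ∧ (∀ r, ψ (-r) = ψ r) ∧
  MonotoneOn φ (Set.Ici 0) ∧ MonotoneOn ψ (Set.Ici 0) ∧
  φ 0 = 0 ∧ ψ 0 = 0

/-- Hypothesis (H2): `ψ` is strictly convex with `ψ''(0) > 0`. -/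
def H2 (ψ : ℝ → ℝ) : Prop :=
  StrictConvexOn ℝ Set.univ ψ ∧ 0 < iteratedDeriv 2 ψ 0

/-- Hypothesis (H3): superlinear growth `ψ(r) ≥ C₀ |r|^p` for `|r| ≥ R₀`. -/
def H3 (ψ : ℝ → ℝ) (p C₀ R₀ : ℝ) : Prop :=
  1 < p ∧ 0 < C₀ ∧ 0 < R₀ ∧ ∀ r : ℝ, R₀ ≤ |r| → C₀ * |r| ^ p ≤ ψ r

/-- An admissible trajectory of the control system `x' = cos θ`, `y' = sin θ`,
`θ' = κ`, `κ' = u` on `[0, T]` steering `W₀` to `W₁`, with control `u ∈ L^p`;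
the final angle is prescribed modulo `2π`. -/
def Connects (p : ℝ) (x y θ κ u : ℝ → ℝ) (T : ℝ)
    (W₀ W₁ : ℝ × ℝ × ℝ × ℝ) : Prop :=
  0 < T ∧ Measurable u ∧
  IntegrableOn (fun t => |u t| ^ p) (Set.Icc 0 T) ∧
  x 0 = W₀.1 ∧ y 0 = W₀.2.1 ∧ θ 0 = W₀.2.2.1 ∧ κ 0 = W₀.2.2.2 ∧
  (∀ t ∈ Set.Icc (0:ℝ) T, x t = x 0 + ∫ s in (0:ℝ)..t, Real.cos (θ s)) ∧
  (∀ t ∈ Set.Icc (0:ℝ) T, y t = y 0 + ∫ s in (0:ℝ)..t, Real.sin (θ s)) ∧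
  (∀ t ∈ Set.Icc (0:ℝ) T, θ t = θ 0 + ∫ s in (0:ℝ)..t, κ s) ∧
  (∀ t ∈ Set.Icc (0:ℝ) T, κ t = κ 0 + ∫ s in (0:ℝ)..t, u s) ∧
  x T = W₁.1 ∧ y T = W₁.2.1 ∧ (∃ k : ℤ, θ T = W₁.2.2.1 + 2 * π * (k : ℝ)) ∧
  κ T = W₁.2.2.2

/-- The cost `C(u,T) = ∫₀ᵀ (1 + φ(κ(t)) + ψ(u(t))) dt`. -/
def cost (φ ψ κ u : ℝ → ℝ) (T : ℝ) : ℝ :=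
  ∫ t in (0:ℝ)..T, (1 + φ (κ t) + ψ (u t))

/-- Optimality: the trajectory is admissible and minimizes the cost among all
admissible trajectories steering `W₀` to `W₁`, over all final times. -/
def IsOptimal (φ ψ : ℝ → ℝ) (p : ℝ) (x y θ κ u : ℝ → ℝ) (T : ℝ)
    (W₀ W₁ : ℝ × ℝ × ℝ × ℝ) : Prop :=
  Connects p x y θ κ u T W₀ W₁ ∧
  ∀ x' y' θ' κ' u' : ℝ → ℝ, ∀ T' : ℝ, Connects p x' y' θ' κ' u' T' W₀ W₁ →
    cost φ ψ κ u T ≤ cost φ ψ κ' u' T'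

/-- The initial point `X₀ = (0, 0, π/2, 0)`. -/
def Xinit : ℝ × ℝ × ℝ × ℝ := (0, 0, π/2, 0)

/-- The constant `C_{φ,ψ} = 8√π (2 + ψ(1) + sup_{s∈[0,√(5π)]} φ(s))`. -/
def Cconst (φ ψ : ℝ → ℝ) : ℝ :=
  8 * Real.sqrt π * (2 + ψ 1 + sSup (φ '' Set.Icc 0 (Real.sqrt (5*π))))

/-- PMP adjoint data `(ρ, φ̂, p₃, p₄)` along a trajectory. -/
def PMPData (φ ψ : ℝ → ℝ) (θ κ u : ℝ → ℝ) (T ρ φh : ℝ) (p₃ p₄ : ℝ → ℝ) : Prop :=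
  0 < ρ ∧ φh ∈ Set.Ico 0 (2*π) ∧
  (∀ t ∈ Set.Icc (0:ℝ) T, p₃ t = p₃ 0 + ∫ s in (0:ℝ)..t, ρ * Real.sin (θ s - φh)) ∧
  (∀ t ∈ Set.Icc (0:ℝ) T, p₄ t = p₄ 0 + ∫ s in (0:ℝ)..t, (-(p₃ s) + deriv φ (κ s))) ∧
  (∀ᵐ t ∂(volume.restrict (Set.Icc (0:ℝ) T)), deriv ψ (u t) = p₄ t) ∧
  (∀ᵐ t ∂(volume.restrict (Set.Icc (0:ℝ) T)),
    ρ * Real.cos (θ t - φh) + p₃ t * κ t + p₄ t * u t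
      - (1 + φ (κ t) + ψ (u t)) = 0)

lemma exists_mem_Icc_le_of_integral_le {f : ℝ → ℝ} {a b δ : ℝ} (hab : a < b)
    (hf : IntervalIntegrable f volume a b) (h : ∫ t in a..b, f t ≤ δ) {P : ℝ → Prop}
    (hP : ∀ᵐ t ∂(volume.restrict (Icc a b)), P t) :
    ∃ t ∈ Icc a b, P t ∧ f t * (b - a) ≤ δ := by
  have hf' : Integrable f (volume.restrict (Icc a b)) :=
    (intervalIntegrable_iff_integrableOn_Icc_of_le hab.le).1 hf
  have hμ : (volume.restrict (Icc a b)) ≠ 0 := by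
    intro h0
    have := congrArg (fun μ => μ univ) h0
    simp at this
    linarith
  have hQ : ∀ᵐ t ∂(volume.restrict (Icc a b)), t ∈ Icc a b ∧ P t :=
    (ae_restrict_mem measurableSet_Icc).and hP
  obtain ⟨t, ht, hle⟩ := exists_notMem_null_le_average hμ hf' (ae_iff.1 hQ)
  simp only [mem_ofPred_eq, not_not] at ht
  refine ⟨t, ht.1, ht.2, ?_⟩
  rw [setAverage_eq] at hle
  rw [integral_Icc_eq_integral_Ioc, ← intervalIntegral.integral_of_le hab.le] at hle
  have hv : (volume.real (Icc a b)) = b - a := by simp [hab.le]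
  rw [hv, smul_eq_mul] at hle
  have hpos : 0 < b - a := sub_pos.2 hab
  calc f t * (b - a) ≤ ((b - a)⁻¹ * ∫ t in a..b, f t) * (b - a) := by gcongr
    _ = ∫ t in a..b, f t := by field_simp
    _ ≤ δ := h

lemma angleDist_le_of_cos_le {a b η : ℝ} (hη : 0 < η)
    (h : Real.cos (min η π) ≤ Real.cos (a - b)) : angleDist a b ≤ η := by
  unfold angleDist
  set B := ((a - b : ℝ) : Real.Angle).toReal with hB
  have hBabs : |B| ≤ π := Real.Angle.abs_toReal_le_pi _
  have hBcoe : ((a - b : ℝ) : Real.Angle) = (B : Real.Angle) := (Real.Angle.coe_toReal _).symm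
  have hnorm : ‖((a - b : ℝ) : Real.Angle)‖ = |B| := by
    rw [hBcoe]
    refine (AddCircle.norm_coe_eq_abs_iff (2 * π) Real.two_pi_pos.ne').2 ?_
    rw [abs_of_pos Real.two_pi_pos]
    linarith
  have hcos : Real.cos (a - b) = Real.cos |B| := by
    rw [Real.cos_abs, hB, Real.Angle.cos_toReal, Real.Angle.cos_coe]
  rw [hnorm]
  by_contra! hlt
  have hm : min η π < |B| ∨ π ≤ min η π := by
    rcases le_total η π with h' | h'
    · left; rwa [min_eq_left h']
    · right; rw [min_eq_right h']
  rcases hm with hm | hm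
  · have := Real.cos_lt_cos_of_nonneg_of_le_pi (le_min hη.le pi_pos.le) hBabs hm
    linarith
  · have : π ≤ η := hm.trans (min_le_left _ _)
    linarith

lemma abs_rpow_integrableOn_imp {u : ℝ → ℝ} {p a b : ℝ} (hp : 1 < p) (hu : Measurable u)
    (h : IntegrableOn (fun t => |u t| ^ p) (Icc a b)) : IntegrableOn u (Icc a b) := by
  have h1 : IntegrableOn (fun _ : ℝ => (1 : ℝ)) (Icc a b) := by simp
  refine (Integrable.add h1 h).mono' hu.aestronglyMeasurable (ae_of_all _ fun t => ?_)
  simp only [Pi.add_apply, Real.norm_eq_abs]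
  rcases le_total |u t| 1 with h' | h'
  · have := Real.rpow_nonneg (abs_nonneg (u t)) p
    linarith
  · have := Real.rpow_le_rpow_of_exponent_le h' hp.le
    rw [Real.rpow_one] at this
    linarith

lemma deriv_smoothTransition_of_nonpos {t : ℝ} (ht : t ≤ 0) :
    deriv smoothTransition t = 0 := by
  refine IsLocalMin.deriv_eq_zero (Filter.Eventually.of_forall fun s => ?_)
  rw [smoothTransition.zero_of_nonpos ht]
  exact smoothTransition.nonneg s

lemma deriv_smoothTransition_of_one_le {t : ℝ} (ht : 1 ≤ t) :
    deriv smoothTransition t = 0 := by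
  refine IsLocalMax.deriv_eq_zero (Filter.Eventually.of_forall fun s => ?_)
  rw [smoothTransition.one_of_one_le ht]
  exact smoothTransition.le_one s

lemma deriv_deriv_smoothTransition_of_nonpos {t : ℝ} (ht : t ≤ 0) :
    deriv (deriv smoothTransition) t = 0 := by
  refine IsLocalMin.deriv_eq_zero (Filter.Eventually.of_forall fun s => ?_)
  rw [deriv_smoothTransition_of_nonpos ht]
  exact smoothTransition.monotone.deriv_nonneg

lemma deriv_deriv_smoothTransition_of_one_le {t : ℝ} (ht : 1 ≤ t) :
    deriv (deriv smoothTransition) t = 0 := by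
  refine IsLocalMin.deriv_eq_zero (Filter.Eventually.of_forall fun s => ?_)
  rw [deriv_smoothTransition_of_one_le ht]
  exact smoothTransition.monotone.deriv_nonneg

lemma contDiff_deriv_smoothTransition : ContDiff ℝ 1 (deriv smoothTransition) :=
  ((contDiff_succ_iff_deriv (n := 1)).1 (smoothTransition.contDiff (n := 2))).2.2

lemma continuous_deriv_smoothTransition : Continuous (deriv smoothTransition) :=
  contDiff_deriv_smoothTransition.continuous

lemma continuous_deriv_deriv_smoothTransition : Continuous (deriv (deriv smoothTransition)) :=
  contDiff_deriv_smoothTransition.continuous_deriv le_rfl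

lemma hasDerivAt_smoothTransition (t : ℝ) :
    HasDerivAt smoothTransition (deriv smoothTransition t) t :=
  ((smoothTransition.contDiff (n := 1)).differentiable one_ne_zero t).hasDerivAt

lemma hasDerivAt_deriv_smoothTransition (t : ℝ) :
    HasDerivAt (deriv smoothTransition) (deriv (deriv smoothTransition) t) t :=
  (contDiff_deriv_smoothTransition.differentiable one_ne_zero t).hasDerivAt

lemma exists_bound_of_continuous_of_eq_zero {g : ℝ → ℝ} (hg : Continuous g)
    (h0 : ∀ t ≤ 0, g t = 0) (h1 : ∀ t, 1 ≤ t → g t = 0) : ∃ K, 0 ≤ K ∧ ∀ t, |g t| ≤ K := by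
  obtain ⟨K, hK⟩ := isCompact_Icc.exists_bound_of_continuousOn (s := Icc (0:ℝ) 1) hg.continuousOn
  have hK0 : 0 ≤ K := (norm_nonneg _).trans (hK 0 (by simp))
  refine ⟨K, hK0, fun t => ?_⟩
  rcases le_total t 0 with h | h
  · rw [h0 t h]; simpa
  rcases le_total t 1 with h' | h'
  · exact hK t ⟨h, h'⟩
  · rw [h1 t h']; simpa

lemma exists_direction_length {dx dy : ℝ → ℝ} (hdx : Continuous dx) (hdy : Continuous dy)
    (bx : ∀ β, |dx β| ≤ 2) (bdy : ∀ β, |dy β| ≤ 2) {r : ℝ} (hr : 8 ≤ r) (α : ℝ) :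
    ∃ β ∈ Icc (α - π / 4) (α + π / 4), ∃ L, 0 ≤ L ∧ L ≤ r + 4 ∧
      r * Real.cos α = dx β + L * Real.cos β ∧ r * Real.sin α = dy β + L * Real.sin β := by
  have hsq : (1.4 : ℝ) < √2 := by
    rw [Real.lt_sqrt (by norm_num)]; norm_num
  have bnd : ∀ β, ∀ a b : ℝ, |a| ≤ 1 → |b| ≤ 1 → |dx β * a + dy β * b| ≤ 4 := by
    intro β a b ha hb
    have h1 : |dx β * a| ≤ 2 * 1 := by
      rw [abs_mul]; exact mul_le_mul (bx β) ha (abs_nonneg _) (by norm_num)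
    have h2 : |dy β * b| ≤ 2 * 1 := by
      rw [abs_mul]; exact mul_le_mul (bdy β) hb (abs_nonneg _) (by norm_num)
    linarith [abs_add_le (dx β * a) (dy β * b)]
  let f : ℝ → ℝ := fun β => r * Real.sin (α - β) + (dx β * Real.sin β + dy β * -Real.cos β)
  have hf : Continuous f := by fun_prop
  have hfa : 0 ≤ f (α - π / 4) := by
    have := (abs_le.1 (bnd (α - π / 4) (Real.sin (α - π / 4)) (-Real.cos (α - π / 4))
      (Real.abs_sin_le_one _) (by rw [abs_neg]; exact Real.abs_cos_le_one _))).1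
    simp only [f, sub_sub_cancel, Real.sin_pi_div_four]
    nlinarith
  have hfb : f (α + π / 4) ≤ 0 := by
    have := (abs_le.1 (bnd (α + π / 4) (Real.sin (α + π / 4)) (-Real.cos (α + π / 4))
      (Real.abs_sin_le_one _) (by rw [abs_neg]; exact Real.abs_cos_le_one _))).2
    have h' : α - (α + π / 4) = -(π / 4) := by ring
    simp only [f, h', Real.sin_neg, Real.sin_pi_div_four]
    nlinarith
  have hle : α - π / 4 ≤ α + π / 4 := by linarith [pi_pos]
  obtain ⟨β, hβ, hfβ⟩ := intermediate_value_Icc' hle hf.continuousOn ⟨hfb, hfa⟩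
  have hcos : √2 / 2 ≤ Real.cos (α - β) := by
    rw [← Real.cos_pi_div_four, ← Real.cos_abs (α - β)]
    refine Real.cos_le_cos_of_nonneg_of_le_pi (abs_nonneg _) (by linarith [pi_pos]) ?_
    rw [abs_le]; constructor <;> linarith [hβ.1, hβ.2]
  have hb := abs_le.1 (bnd β (Real.cos β) (Real.sin β) (Real.abs_cos_le_one _)
    (Real.abs_sin_le_one _))
  simp only [f, Real.sin_sub] at hfβ
  have hsc := Real.sin_sq_add_cos_sq β
  refine ⟨β, hβ, r * Real.cos (α - β) - (dx β * Real.cos β + dy β * Real.sin β), ?_, ?_, ?_, ?_⟩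
  · nlinarith
  · nlinarith [Real.cos_le_one (α - β)]
  · rw [Real.cos_sub]
    linear_combination (-Real.sin β) * hfβ + (dx β - r * Real.cos α) * hsc
  · rw [Real.cos_sub]
    linear_combination (Real.cos β) * hfβ + (dy β - r * Real.sin α) * hsc

lemma le_of_abs_le_of_even_monotoneOn {f : ℝ → ℝ} (he : ∀ r, f (-r) = f r)
    (hm : MonotoneOn f (Ici 0)) {a b : ℝ} (h : |a| ≤ b) : f a ≤ f b := by
  have : f a = f |a| := by
    rcases abs_choice a with h' | h' <;> rw [h']
    exact (he a).symm
  rw [this]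
  exact hm (abs_nonneg a) ((abs_nonneg a).trans h) h

lemma exists_competitor {φ ψ : ℝ → ℝ} (h1 : H1 φ ψ) {p : ℝ} (hp : 1 < p) :
    ∃ C, ∀ r, 8 ≤ r → ∀ α ∈ Ico 0 (2 * π), ∀ θ₁, ∃ x y θ κ u : ℝ → ℝ, ∃ T,
      Connects p x y θ κ u T Xinit (r * Real.cos α, r * Real.sin α, θ₁, 0) ∧
      cost φ ψ κ u T ≤ r + C := by
  obtain ⟨hφ0, hψ0, hφc, hψc, hφe, hψe, hφm, hψm, hφz, hψz⟩ := h1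
  obtain ⟨K₁, hK₁, hb₁⟩ := exists_bound_of_continuous_of_eq_zero
    continuous_deriv_smoothTransition (fun t => deriv_smoothTransition_of_nonpos)
    (fun t => deriv_smoothTransition_of_one_le)
  obtain ⟨K₂, hK₂, hb₂⟩ := exists_bound_of_continuous_of_eq_zero
    continuous_deriv_deriv_smoothTransition (fun t => deriv_deriv_smoothTransition_of_nonpos)
    (fun t => deriv_deriv_smoothTransition_of_one_le)
  set M := φ (6 * π * K₁) + ψ (6 * π * K₂) with hM
  refine ⟨6 + 2 * M, fun r hr α hα θ₁ => ?_⟩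
  set σ := smoothTransition with hσ
  have hσc : Continuous σ := smoothTransition.continuous
  set θf := toIcoMod Real.two_pi_pos 0 θ₁ with hθf
  have hθf_mem : θf ∈ Ico 0 (0 + 2 * π) := toIcoMod_mem_Ico Real.two_pi_pos 0 θ₁
  have hθf_eq : θf = θ₁ + 2 * π * ((-(toIcoDiv Real.two_pi_pos 0 θ₁) : ℤ) : ℝ) := by
    rw [hθf, toIcoMod, zsmul_eq_mul]; push_cast; ring
  let dx : ℝ → ℝ := fun β => (∫ s in (0:ℝ)..1, Real.cos (π / 2 + (β - π / 2) * σ s)) +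
    ∫ s in (0:ℝ)..1, Real.cos (β + (θf - β) * σ s)
  let dy : ℝ → ℝ := fun β => (∫ s in (0:ℝ)..1, Real.sin (π / 2 + (β - π / 2) * σ s)) +
    ∫ s in (0:ℝ)..1, Real.sin (β + (θf - β) * σ s)
  have hdx : Continuous dx := by
    refine Continuous.add ?_ ?_ <;>
      refine intervalIntegral.continuous_parametric_intervalIntegral_of_continuous' ?_ _ _ <;>
      (simp only [Function.uncurry_def]; fun_prop)
  have hdy : Continuous dy := by
    refine Continuous.add ?_ ?_ <;>
      refine intervalIntegral.continuous_parametric_intervalIntegral_of_continuous' ?_ _ _ <;>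
      (simp only [Function.uncurry_def]; fun_prop)
  have bnd1 : ∀ g : ℝ → ℝ, (∀ s, |g s| ≤ 1) → |∫ s in (0:ℝ)..1, g s| ≤ 1 := by
    intro g hg
    have := intervalIntegral.norm_integral_le_of_norm_le_const (a := 0) (b := 1) (f := g) (C := 1)
      (fun s _ => hg s)
    simpa using this
  have bdx : ∀ β, |dx β| ≤ 2 := fun β => by
    have ha := bnd1 _ fun s => Real.abs_cos_le_one (π / 2 + (β - π / 2) * σ s)
    have hb := bnd1 _ fun s => Real.abs_cos_le_one (β + (θf - β) * σ s)
    exact (abs_add_le _ _).trans (by linarith)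
  have bdy : ∀ β, |dy β| ≤ 2 := fun β => by
    have ha := bnd1 _ fun s => Real.abs_sin_le_one (π / 2 + (β - π / 2) * σ s)
    have hb := bnd1 _ fun s => Real.abs_sin_le_one (β + (θf - β) * σ s)
    exact (abs_add_le _ _).trans (by linarith)
  obtain ⟨β, hβ, L, hL0, hLr, hX, hY⟩ := exists_direction_length hdx hdy bdx bdy hr α
  have hpi := pi_pos
  set Δ₁ := β - π / 2 with hΔ₁
  set Δ₂ := θf - β with hΔ₂
  have hΔ : |Δ₁| + |Δ₂| ≤ 6 * π := by
    have ha : |Δ₁| ≤ 3 * π := by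
      rw [abs_le]; constructor <;> linarith [hβ.1, hβ.2, hα.1, hα.2]
    have hb : |Δ₂| ≤ 3 * π := by
      rw [abs_le]; constructor <;>
        linarith [hβ.1, hβ.2, hα.1, hα.2, hθf_mem.1, hθf_mem.2]
    linarith
  let θ : ℝ → ℝ := fun t => π / 2 + Δ₁ * σ t + Δ₂ * σ (t - (1 + L))
  let κ : ℝ → ℝ := fun t => Δ₁ * deriv σ t + Δ₂ * deriv σ (t - (1 + L))
  let u : ℝ → ℝ := fun t => Δ₁ * deriv (deriv σ) t + Δ₂ * deriv (deriv σ) (t - (1 + L))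
  have hκc : Continuous κ :=
    (continuous_const.mul continuous_deriv_smoothTransition).add
      (continuous_const.mul (continuous_deriv_smoothTransition.comp (by fun_prop)))
  have huc : Continuous u :=
    (continuous_const.mul continuous_deriv_deriv_smoothTransition).add
      (continuous_const.mul (continuous_deriv_deriv_smoothTransition.comp (by fun_prop)))
  have hθc : Continuous θ := by fun_prop
  have hθd : ∀ t, HasDerivAt θ (κ t) t := fun t =>
    (((hasDerivAt_smoothTransition t).const_mul Δ₁).const_add (π / 2)).add
      (((hasDerivAt_smoothTransition (t - (1 + L))).comp_sub_const t (1 + L)).const_mul Δ₂)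
  have hκd : ∀ t, HasDerivAt κ (u t) t := fun t =>
    ((hasDerivAt_deriv_smoothTransition t).const_mul Δ₁).add
      (((hasDerivAt_deriv_smoothTransition (t - (1 + L))).comp_sub_const t (1 + L)).const_mul Δ₂)
  have hθ_first : ∀ t ∈ Icc (0:ℝ) 1, θ t = π / 2 + Δ₁ * σ t := fun t ht => by
    simp only [θ, hσ, smoothTransition.zero_of_nonpos (by linarith [ht.2] : t - (1 + L) ≤ 0)]
    ring
  have hθ_mid : ∀ t ∈ Icc (1:ℝ) (1 + L), θ t = β := fun t ht => by
    simp only [θ, hσ, smoothTransition.zero_of_nonpos (by linarith [ht.2] : t - (1 + L) ≤ 0),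
      smoothTransition.one_of_one_le ht.1]
    ring
  have hθ_last : ∀ t ∈ Icc (1 + L) (2 + L), θ t = β + Δ₂ * σ (t - (1 + L)) := fun t ht => by
    simp only [θ, hσ, smoothTransition.one_of_one_le (by linarith [ht.1] : 1 ≤ t)]
    ring
  have split : ∀ g : ℝ → ℝ, Continuous g → ∫ t in (0:ℝ)..(2 + L), g t =
      (∫ t in (0:ℝ)..1, g t) + (∫ t in (1:ℝ)..(1 + L), g t) + ∫ t in (1 + L)..(2 + L), g t := by
    intro g hg
    rw [intervalIntegral.integral_add_adjacent_intervals (hg.intervalIntegrable _ _)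
      (hg.intervalIntegrable _ _),
      intervalIntegral.integral_add_adjacent_intervals (hg.intervalIntegrable _ _)
      (hg.intervalIntegrable _ _)]
  have pos_int : ∀ g : ℝ → ℝ, Continuous g → ∫ t in (0:ℝ)..(2 + L), g (θ t) =
      (∫ s in (0:ℝ)..1, g (π / 2 + Δ₁ * σ s)) + (∫ s in (0:ℝ)..1, g (β + Δ₂ * σ s))
        + L * g β := by
    intro g hg
    rw [split (fun t => g (θ t)) (hg.comp hθc)]
    have e1 : ∫ t in (0:ℝ)..1, g (θ t) = ∫ s in (0:ℝ)..1, g (π / 2 + Δ₁ * σ s) := by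
      refine intervalIntegral.integral_congr fun t ht => ?_
      rw [uIcc_of_le zero_le_one] at ht
      simp only [hθ_first t ht]
    have e2 : ∫ t in (1:ℝ)..(1 + L), g (θ t) = L * g β := by
      have : ∫ t in (1:ℝ)..(1 + L), g (θ t) = ∫ t in (1:ℝ)..(1 + L), g β := by
        refine intervalIntegral.integral_congr fun t ht => ?_
        rw [uIcc_of_le (by linarith)] at ht
        simp only [hθ_mid t ht]
      rw [this]; simp
    have e3 : ∫ t in (1 + L)..(2 + L), g (θ t) = ∫ s in (0:ℝ)..1, g (β + Δ₂ * σ s) := by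
      have : ∫ t in (1 + L)..(2 + L), g (θ t) =
          ∫ t in (1 + L)..(2 + L), g (β + Δ₂ * σ (t - (1 + L))) := by
        refine intervalIntegral.integral_congr fun t ht => ?_
        rw [uIcc_of_le (by linarith)] at ht
        simp only [hθ_last t ht]
      rw [this, intervalIntegral.integral_comp_sub_right (fun t => g (β + Δ₂ * σ t)) (1 + L)]
      congr 1 <;> ring
    rw [e1, e2, e3]
    ring
  have habs : ∀ (a b K : ℝ), |a| ≤ K → |b| ≤ K → |Δ₁ * a + Δ₂ * b| ≤ 6 * π * K := by
    intro a b K ha hb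
    calc |Δ₁ * a + Δ₂ * b| ≤ |Δ₁| * |a| + |Δ₂| * |b| := by
          rw [← abs_mul, ← abs_mul]; exact abs_add_le _ _
      _ ≤ |Δ₁| * K + |Δ₂| * K := by gcongr
      _ = (|Δ₁| + |Δ₂|) * K := by ring
      _ ≤ 6 * π * K := by
        have : 0 ≤ K := (abs_nonneg _).trans ha
        gcongr
  have hcostc : Continuous fun t => 1 + φ (κ t) + ψ (u t) :=
    (continuous_const.add (hφc.continuous.comp hκc)).add (hψc.continuous.comp huc)
  have hbound : ∀ t, 1 + φ (κ t) + ψ (u t) ≤ 1 + M := fun t => by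
    have ha := le_of_abs_le_of_even_monotoneOn hφe hφm (habs _ _ _ (hb₁ t) (hb₁ (t - (1 + L))))
    have hb := le_of_abs_le_of_even_monotoneOn hψe hψm (habs _ _ _ (hb₂ t) (hb₂ (t - (1 + L))))
    linarith
  have hpiece : ∀ a b : ℝ, b = a + 1 → ∫ t in a..b, (1 + φ (κ t) + ψ (u t)) ≤ 1 + M := by
    rintro a b rfl
    have := intervalIntegral.integral_mono_on (by linarith : a ≤ a + 1)
      (hcostc.intervalIntegrable (μ := volume) a (a + 1))
      (continuous_const.intervalIntegrable (μ := volume) a (a + 1))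
      (fun t _ => hbound t)
    simpa using this
  have hmid : ∫ t in (1:ℝ)..(1 + L), (1 + φ (κ t) + ψ (u t)) = L := by
    have : ∫ t in (1:ℝ)..(1 + L), (1 + φ (κ t) + ψ (u t)) = ∫ t in (1:ℝ)..(1 + L), (1:ℝ) := by
      refine intervalIntegral.integral_congr fun t ht => ?_
      rw [uIcc_of_le (by linarith)] at ht
      have hle : t - (1 + L) ≤ 0 := by linarith [ht.2]
      simp only [κ, u, hσ, deriv_smoothTransition_of_nonpos hle,
        deriv_smoothTransition_of_one_le ht.1, deriv_deriv_smoothTransition_of_nonpos hle,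
        deriv_deriv_smoothTransition_of_one_le ht.1, mul_zero, add_zero, hφz, hψz]
    rw [this]; simp
  refine ⟨fun t => ∫ s in (0:ℝ)..t, Real.cos (θ s), fun t => ∫ s in (0:ℝ)..t, Real.sin (θ s),
    θ, κ, u, 2 + L, ⟨by linarith, huc.measurable, ?_, ?_, ?_, ?_, ?_, ?_, ?_, ?_, ?_, ?_, ?_,
    ⟨-(toIcoDiv Real.two_pi_pos 0 θ₁), ?_⟩, ?_⟩, ?_⟩
  · exact (Continuous.rpow_const huc.abs fun _ => Or.inr (by linarith)).continuousOn.integrableOn_Icc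
  · simp [Xinit]
  · simp [Xinit]
  · rw [hθ_first 0 (by simp)]
    simp [Xinit, hσ]
  · simp only [κ, hσ, Xinit, deriv_smoothTransition_of_nonpos le_rfl,
      deriv_smoothTransition_of_nonpos (by linarith : 0 - (1 + L) ≤ 0)]
    ring
  · simp
  · simp
  · intro t _
    rw [intervalIntegral.integral_eq_sub_of_hasDerivAt (fun s _ => hθd s)
      (hκc.intervalIntegrable _ _)]
    ring
  · intro t _
    rw [intervalIntegral.integral_eq_sub_of_hasDerivAt (fun s _ => hκd s)
      (huc.intervalIntegrable _ _)]
    ring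
  · exact (pos_int _ Real.continuous_cos).trans hX.symm
  · exact (pos_int _ Real.continuous_sin).trans hY.symm
  · rw [← hθf_eq, hθ_last _ ⟨by linarith, le_rfl⟩, hσ,
      smoothTransition.one_of_one_le (by linarith)]
    ring
  · simp only [κ, hσ, deriv_smoothTransition_of_one_le (by linarith : 1 ≤ 2 + L),
      deriv_smoothTransition_of_one_le (by linarith : 1 ≤ 2 + L - (1 + L))]
    ring
  · unfold cost
    rw [split _ hcostc, hmid]
    have ha := hpiece 0 1 (by ring)
    have hb := hpiece (1 + L) (2 + L) (by ring)
    linarith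

lemma exists_abs_le_add_mul {ψ : ℝ → ℝ} (hψ0 : ∀ r, 0 ≤ ψ r) (hψz : ψ 0 = 0)
    (hψe : ∀ r, ψ (-r) = ψ r) (hψ : StrictConvexOn ℝ univ ψ) {ε : ℝ} (hε : 0 < ε) :
    ∃ K > 0, ∀ v, |v| ≤ ε + K * ψ v := by
  have hpos : 0 < ψ ε := by
    have h := hψ.2 (mem_univ ε) (mem_univ (-ε)) (fun h => by linarith)
      (by norm_num : (0 : ℝ) < 1 / 2) (by norm_num : (0 : ℝ) < 1 / 2) (by norm_num)
    simp only [smul_eq_mul, hψe] at h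
    have h0 : (1 / 2 : ℝ) * ε + 1 / 2 * -ε = 0 := by ring
    rw [h0, hψz] at h
    linarith
  refine ⟨ε / ψ ε, by positivity, fun v => ?_⟩
  have hv : ψ |v| = ψ v := by
    rcases abs_choice v with h | h <;> rw [h]
    exact hψe v
  rcases le_total |v| ε with h | h
  · have := mul_nonneg (div_pos hε hpos).le (hψ0 v)
    linarith
  · have hvp : 0 < |v| := hε.trans_le h
    have hc := hψ.convexOn.2 (mem_univ |v|) (mem_univ 0)
      (by positivity : 0 ≤ ε / |v|)
      (by rw [sub_nonneg, div_le_one hvp]; exact h : 0 ≤ 1 - ε / |v|) (by ring)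
    simp only [smul_eq_mul, mul_zero, add_zero, hψz, hv] at hc
    rw [div_mul_cancel₀ _ hvp.ne'] at hc
    have h2 : ψ ε * |v| ≤ ε * ψ v := by
      calc ψ ε * |v| ≤ (ε / |v| * ψ v) * |v| := by gcongr
        _ = ε * ψ v := by field_simp
    have h3 : |v| ≤ ε / ψ ε * ψ v := by
      rw [div_mul_eq_mul_div, le_div_iff₀ hpos]; linarith
    linarith

lemma sin_sq_le_two_mul_one_sub_cos (w : ℝ) : Real.sin w ^ 2 ≤ 2 * (1 - Real.cos w) := by
  nlinarith [Real.sin_sq_add_cos_sq w, sq_nonneg (1 - Real.cos w)]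

lemma abs_sin_sub_sub_sin_sub_le (x α b : ℝ) :
    |Real.sin (x - b) - Real.sin (α - b)| ≤ (1 - Real.cos (x - α)) + |Real.sin (x - α)| := by
  have h : x - b = (α - b) + (x - α) := by ring
  rw [h, Real.sin_add]
  have h1 : |Real.sin (α - b) * (Real.cos (x - α) - 1)| ≤ 1 * (1 - Real.cos (x - α)) := by
    rw [abs_mul, abs_of_nonpos (by linarith [Real.cos_le_one (x - α)] : Real.cos (x - α) - 1 ≤ 0)]
    have := Real.abs_sin_le_one (α - b)
    have := Real.cos_le_one (x - α)
    nlinarith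
  have h2 : |Real.cos (α - b) * Real.sin (x - α)| ≤ 1 * |Real.sin (x - α)| := by
    rw [abs_mul]
    exact mul_le_mul_of_nonneg_right (Real.abs_cos_le_one _) (abs_nonneg _)
  have h3 := abs_add_le (Real.sin (α - b) * (Real.cos (x - α) - 1))
    (Real.cos (α - b) * Real.sin (x - α))
  rw [show Real.sin (α - b) * Real.cos (x - α) + Real.cos (α - b) * Real.sin (x - α)
    - Real.sin (α - b) = Real.sin (α - b) * (Real.cos (x - α) - 1)
      + Real.cos (α - b) * Real.sin (x - α) by ring]
  linarith

lemma abs_cos_sub_sub_cos_sub_le (x α b : ℝ) :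
    |Real.cos (x - b) - Real.cos (α - b)| ≤ (1 - Real.cos (x - α)) + |Real.sin (x - α)| := by
  have h := abs_sin_sub_sub_sin_sub_le x α (b - π / 2)
  rwa [show x - (b - π / 2) = (x - b) + π / 2 by ring,
    show α - (b - π / 2) = (α - b) + π / 2 by ring, Real.sin_add_pi_div_two,
    Real.sin_add_pi_div_two] at h

lemma hasDerivAt_of_sub_eq_integral {θ κ : ℝ → ℝ} {a b : ℝ} (hκ : ContinuousOn κ (Icc a b))
    (h : ∀ s ∈ Icc a b, ∀ t ∈ Icc a b, θ t - θ s = ∫ r in s..t, κ r) {t : ℝ}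
    (ht : t ∈ Ioo a b) : HasDerivAt θ (κ t) t := by
  have hab : a ≤ b := (ht.1.trans ht.2).le
  have hmem : Icc a b ∈ nhds t := Icc_mem_nhds ht.1 ht.2
  have hint : IntervalIntegrable κ volume a t :=
    (hκ.mono (Icc_subset_Icc_right ht.2.le)).intervalIntegrable_of_Icc ht.1.le
  have hd := intervalIntegral.integral_hasDerivAt_right hint
    ⟨Icc a b, hmem, hκ.aestronglyMeasurable measurableSet_Icc⟩ (hκ.continuousAt hmem)
  refine (hd.const_add (θ a)).congr_of_eventuallyEq ?_
  filter_upwards [hmem] with s hs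
  rw [← h a (left_mem_Icc.2 hab) s hs]
  ring

lemma integral_le_integral_of_subinterval {f : ℝ → ℝ} {a b c d : ℝ} (hac : a ≤ c) (hcd : c ≤ d)
    (hdb : d ≤ b) (hf0 : ∀ t, 0 ≤ f t) (hf : IntervalIntegrable f volume a b) :
    IntervalIntegrable f volume c d ∧ ∫ t in c..d, f t ≤ ∫ t in a..b, f t := by
  refine ⟨hf.mono_set ?_, intervalIntegral.integral_mono_interval hac hcd hdb
    (ae_of_all _ hf0) hf⟩
  rw [uIcc_of_le hcd, uIcc_of_le (hac.trans (hcd.trans hdb))]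
  exact Icc_subset_Icc hac hdb

lemma abs_curvature_le {θ κ : ℝ → ℝ} {a α ε δ : ℝ} (hκ : ContinuousOn κ (Icc a (a + 1)))
    (hθ : ContinuousOn θ (Icc a (a + 1)))
    (h : ∀ s ∈ Icc a (a + 1), ∀ t ∈ Icc a (a + 1), θ t - θ s = ∫ r in s..t, κ r)
    (hosc : ∀ s ∈ Icc a (a + 1), ∀ t ∈ Icc a (a + 1), |κ t - κ s| ≤ ε)
    (hε : 0 ≤ ε) (hδ4 : δ ≤ 1 / 4) (hδε : 8 * δ ≤ ε ^ 2)
    (hI : ∫ t in a..(a + 1), (1 - Real.cos (θ t - α)) ≤ δ) :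
    ∀ t ∈ Icc a (a + 1), |κ t| ≤ 11 * ε := by
  intro t₀ ht₀
  have hnn : ∀ t, 0 ≤ 1 - Real.cos (θ t - α) := fun t => by linarith [Real.cos_le_one (θ t - α)]
  have hcosc : ContinuousOn (fun t => Real.cos (θ t - α)) (Icc a (a + 1)) :=
    Real.continuous_cos.comp_continuousOn (hθ.sub continuousOn_const)
  have hcc : ContinuousOn (fun t => 1 - Real.cos (θ t - α)) (Icc a (a + 1)) :=
    continuousOn_const.sub hcosc
  have hint : IntervalIntegrable (fun t => 1 - Real.cos (θ t - α)) volume a (a + 1) :=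
    hcc.intervalIntegrable_of_Icc (by linarith)
  have good : ∀ c d, a ≤ c → d = c + 1 / 4 → d ≤ a + 1 →
      ∃ t ∈ Icc c d, |Real.sin (θ t - α)| ≤ ε := by
    rintro c d hc rfl hd
    obtain ⟨hi, hle⟩ := integral_le_integral_of_subinterval hc (by linarith) hd hnn hint
    obtain ⟨t, ht, -, hb⟩ := exists_mem_Icc_le_of_integral_le (P := fun _ => True)
      (by linarith) hi (hle.trans hI) (ae_of_all _ fun _ => trivial)
    refine ⟨t, ht, abs_le_of_sq_le_sq ?_ hε⟩
    have := sin_sq_le_two_mul_one_sub_cos (θ t - α)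
    nlinarith
  obtain ⟨c, hc, hcs⟩ := good a (a + 1 / 4) le_rfl rfl (by linarith)
  obtain ⟨d, hd, hds⟩ := good (a + 3 / 4) (a + 1) (by linarith) (by ring) le_rfl
  have hcd : c ≤ d := by linarith [hc.2, hd.1]
  have hsub : Icc c d ⊆ Icc a (a + 1) := Icc_subset_Icc hc.1 hd.2
  have hFTC : ∫ t in c..d, Real.cos (θ t - α) * κ t =
      Real.sin (θ d - α) - Real.sin (θ c - α) := by
    refine intervalIntegral.integral_eq_sub_of_hasDerivAt_of_le
      (f := fun t => Real.sin (θ t - α)) hcd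
      (Real.continuous_sin.comp_continuousOn ((hθ.mono hsub).sub continuousOn_const)) ?_
      (((hcosc.mul hκ).mono hsub).intervalIntegrable_of_Icc hcd)
    intro t ht
    have hd' := hasDerivAt_of_sub_eq_integral hκ h
      (t := t) ⟨hc.1.trans_lt ht.1, ht.2.trans_le hd.2⟩
    exact (hd'.sub_const α).sin
  set k := κ t₀
  have hgi : IntervalIntegrable (fun t => ε + (|k| + ε) * (1 - Real.cos (θ t - α))) volume c d :=
    ((continuousOn_const.add (continuousOn_const.mul hcc)).mono hsub).intervalIntegrable_of_Icc hcd
  have hdiff : |∫ t in c..d, (k - Real.cos (θ t - α) * κ t)| ≤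
      ∫ t in c..d, (ε + (|k| + ε) * (1 - Real.cos (θ t - α))) := by
    rw [← Real.norm_eq_abs]
    refine intervalIntegral.norm_integral_le_of_norm_le hcd (ae_of_all _ fun t ht => ?_) hgi
    have hmem := hsub (Ioc_subset_Icc_self ht)
    have ho := hosc t hmem t₀ ht₀
    have ho' : |κ t| ≤ |k| + ε := by
      have := abs_sub_abs_le_abs_sub (κ t) k
      rw [abs_sub_comm] at this
      linarith
    rw [Real.norm_eq_abs, show k - Real.cos (θ t - α) * κ t =
      (k - κ t) + κ t * (1 - Real.cos (θ t - α)) by ring]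
    refine (abs_add_le _ _).trans ?_
    rw [abs_mul, abs_of_nonneg (hnn t)]
    exact add_le_add ho (mul_le_mul_of_nonneg_right ho' (hnn t))
  have hi1 : IntervalIntegrable (fun t => Real.cos (θ t - α) * κ t) volume c d :=
    ((hcosc.mul hκ).mono hsub).intervalIntegrable_of_Icc hcd
  rw [intervalIntegral.integral_sub (by simp) hi1, hFTC] at hdiff
  obtain ⟨hi2, hle2⟩ := integral_le_integral_of_subinterval hc.1 hcd hd.2 hnn hint
  rw [intervalIntegral.integral_add (by simp) (hi2.const_mul _),
    intervalIntegral.integral_const_mul] at hdiff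
  simp only [intervalIntegral.integral_const, smul_eq_mul] at hdiff
  have hk0 := abs_nonneg k
  have hA : |(d - c) * k| ≤ 2 * ε + ((d - c) * ε + (|k| + ε) * δ) := by
    have h3 : (|k| + ε) * ∫ t in c..d, (1 - Real.cos (θ t - α)) ≤ (|k| + ε) * δ :=
      mul_le_mul_of_nonneg_left (hle2.trans hI) (by linarith)
    rw [abs_le] at hcs hds hdiff ⊢
    constructor <;> linarith [hdiff.1, hdiff.2, hcs.1, hcs.2, hds.1, hds.2]
  rw [abs_mul, abs_of_nonneg (by linarith : 0 ≤ d - c)] at hA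
  have hcd2 : 1 / 2 ≤ d - c := by linarith [hc.2, hd.1]
  have hcd1 : d - c ≤ 1 := by linarith [hc.1, hd.2]
  nlinarith

lemma exists_window_estimates {φ ψ : ℝ → ℝ} (h1 : H1 φ ψ) (h2 : H2 ψ) {ε : ℝ} (hε : 0 < ε)
    (hε1 : ε ≤ 1) : ∃ δ > 0, ∀ (θ κ u : ℝ → ℝ) (a α : ℝ),
      IntervalIntegrable u volume a (a + 1) →
      ContinuousOn κ (Icc a (a + 1)) → ContinuousOn θ (Icc a (a + 1)) →
      (∀ s ∈ Icc a (a + 1), ∀ t ∈ Icc a (a + 1), κ t - κ s = ∫ r in s..t, u r) →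
      (∀ s ∈ Icc a (a + 1), ∀ t ∈ Icc a (a + 1), θ t - θ s = ∫ r in s..t, κ r) →
      IntervalIntegrable (fun t => ψ (u t)) volume a (a + 1) →
      ∫ t in a..(a + 1), (1 - Real.cos (θ t - α) + φ (κ t) + ψ (u t)) ≤ δ →
      (∀ t ∈ Icc a (a + 1), |κ t| ≤ ε ∧ ∀ b, |Real.sin (θ t - b) - Real.sin (α - b)| ≤ ε ∧
        |Real.cos (θ t - b) - Real.cos (α - b)| ≤ ε) ∧
      ∀ c d, a ≤ c → d = c + 1 / 7 → d ≤ a + 1 → ∀ P : ℝ → Prop,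
        (∀ᵐ t ∂(volume.restrict (Icc c d)), P t) →
        ∃ t ∈ Icc c d, P t ∧ |u t| ≤ ε ∧ ψ (u t) ≤ ε := by
  obtain ⟨hφ0, hψ0, hφc, hψc, hφe, hψe, hφm, hψm, hφz, hψz⟩ := h1
  set ε₁ := ε / 33 with hε₁
  have hε₁0 : 0 < ε₁ := by positivity
  obtain ⟨K, hK, hKv⟩ := exists_abs_le_add_mul hψ0 hψz hψe h2.1 (half_pos hε₁0)
  set δ := min (ε₁ / (2 * K)) (ε₁ ^ 2 / 8) with hδ
  have hδ0 : 0 < δ := by positivity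
  have hδK : K * δ ≤ ε₁ / 2 := by
    calc K * δ ≤ K * (ε₁ / (2 * K)) := by gcongr; exact min_le_left _ _
      _ = ε₁ / 2 := by field_simp
  have hδ8 : 8 * δ ≤ ε₁ ^ 2 := by linarith [min_le_right (ε₁ / (2 * K)) (ε₁ ^ 2 / 8)]
  have hsq : ε₁ ^ 2 ≤ ε₁ := by nlinarith
  refine ⟨δ, hδ0, fun θ κ u a α hu hκ hθ hκu hθκ hψu hI => ?_⟩
  have hnn : ∀ t, 0 ≤ 1 - Real.cos (θ t - α) := fun t => by linarith [Real.cos_le_one (θ t - α)]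
  have hcos : IntervalIntegrable (fun t => 1 - Real.cos (θ t - α)) volume a (a + 1) :=
    (continuousOn_const.sub (Real.continuous_cos.comp_continuousOn
      (hθ.sub continuousOn_const))).intervalIntegrable_of_Icc (by linarith)
  have hφκ : IntervalIntegrable (fun t => φ (κ t)) volume a (a + 1) :=
    (hφc.continuous.comp_continuousOn hκ).intervalIntegrable_of_Icc (by linarith)
  have hsum : IntervalIntegrable (fun t => 1 - Real.cos (θ t - α) + φ (κ t) + ψ (u t)) volume
      a (a + 1) := (hcos.add hφκ).add hψu
  have hIcos : ∫ t in a..(a + 1), (1 - Real.cos (θ t - α)) ≤ δ :=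
    (intervalIntegral.integral_mono_on (by linarith) hcos hsum
      fun t _ => by linarith [hφ0 (κ t), hψ0 (u t)]).trans hI
  have hIψ : ∫ t in a..(a + 1), ψ (u t) ≤ δ :=
    (intervalIntegral.integral_mono_on (by linarith) hψu hsum
      fun t _ => by linarith [hφ0 (κ t), hnn t]).trans hI
  have hosc' : ∀ s ∈ Icc a (a + 1), ∀ t ∈ Icc a (a + 1), s ≤ t → |κ t - κ s| ≤ ε₁ := by
    intro s hs t ht hst
    obtain ⟨hi, hle⟩ := integral_le_integral_of_subinterval hs.1 hst ht.2 (fun t => hψ0 (u t)) hψu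
    have hb : ‖∫ r in s..t, u r‖ ≤ ∫ r in s..t, (ε₁ / 2 + K * ψ (u r)) :=
      intervalIntegral.norm_integral_le_of_norm_le hst (ae_of_all _ fun r _ => hKv (u r))
        (intervalIntegrable_const.add (hi.const_mul K))
    rw [Real.norm_eq_abs, intervalIntegral.integral_add (by simp) (hi.const_mul K),
      intervalIntegral.integral_const_mul, intervalIntegral.integral_const, smul_eq_mul] at hb
    rw [hκu s hs t ht]
    have h3 : K * ∫ r in s..t, ψ (u r) ≤ K * δ :=
      mul_le_mul_of_nonneg_left (hle.trans hIψ) hK.le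
    have h4 : (t - s) * (ε₁ / 2) ≤ 1 * (ε₁ / 2) :=
      mul_le_mul_of_nonneg_right (by linarith [ht.2, hs.1]) (by linarith)
    linarith
  have hosc : ∀ s ∈ Icc a (a + 1), ∀ t ∈ Icc a (a + 1), |κ t - κ s| ≤ ε₁ := by
    intro s hs t ht
    rcases le_total s t with h | h
    · exact hosc' s hs t ht h
    · rw [abs_sub_comm]; exact hosc' t ht s hs h
  have hκsmall : ∀ t ∈ Icc a (a + 1), |κ t| ≤ ε / 3 := fun t ht =>
    (abs_curvature_le hκ hθ hθκ hosc hε₁0.le (by nlinarith) hδ8 hIcos t ht).trans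
      (by rw [hε₁]; linarith)
  obtain ⟨r, hr, -, hrδ⟩ := exists_mem_Icc_le_of_integral_le (P := fun _ => True)
    (by linarith) hcos hIcos (ae_of_all _ fun _ => trivial)
  have hrsin : |Real.sin (θ r - α)| ≤ ε₁ := by
    refine abs_le_of_sq_le_sq ?_ hε₁0.le
    have := sin_sq_le_two_mul_one_sub_cos (θ r - α)
    nlinarith
  have hθr : ∀ t ∈ Icc a (a + 1), |θ t - θ r| ≤ ε / 3 := by
    intro t ht
    rw [hθκ r hr t ht]
    have hb := intervalIntegral.norm_integral_le_of_norm_le_const (a := r) (b := t) (f := κ)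
      (C := ε / 3) fun s hs => hκsmall s (by
        have hs' := uIoc_subset_uIcc hs
        rw [mem_uIcc] at hs'
        rcases hs' with h | h
        · exact ⟨hr.1.trans h.1, h.2.trans ht.2⟩
        · exact ⟨ht.1.trans h.1, h.2.trans hr.2⟩)
    rw [Real.norm_eq_abs] at hb
    have h4 : |t - r| ≤ 1 := by
      rw [abs_le]; constructor <;> linarith [ht.1, ht.2, hr.1, hr.2]
    nlinarith
  refine ⟨fun t ht => ⟨(hκsmall t ht).trans (by linarith), fun b => ⟨?_, ?_⟩⟩, ?_⟩
  · have ha := abs_sin_sub_sub_sin_sub_le (θ r) α b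
    have hb : |Real.sin (θ t - b) - Real.sin (θ r - b)| ≤ |θ t - θ r| := by
      have := Real.abs_sin_sub_sin_le (θ t - b) (θ r - b)
      rwa [sub_sub_sub_cancel_right] at this
    have hc := abs_add_le (Real.sin (θ t - b) - Real.sin (θ r - b))
      (Real.sin (θ r - b) - Real.sin (α - b))
    rw [sub_add_sub_cancel] at hc
    have := hθr t ht
    linarith
  · have ha := abs_cos_sub_sub_cos_sub_le (θ r) α b
    have hb : |Real.cos (θ t - b) - Real.cos (θ r - b)| ≤ |θ t - θ r| := by
      have := Real.abs_cos_sub_cos_le (θ t - b) (θ r - b)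
      rwa [sub_sub_sub_cancel_right] at this
    have hc := abs_add_le (Real.cos (θ t - b) - Real.cos (θ r - b))
      (Real.cos (θ r - b) - Real.cos (α - b))
    rw [sub_add_sub_cancel] at hc
    have := hθr t ht
    linarith
  · rintro c d hc rfl hd P hP
    obtain ⟨hi, hle⟩ := integral_le_integral_of_subinterval hc (by linarith) hd
      (fun t => hψ0 (u t)) hψu
    obtain ⟨t, ht, hPt, hb⟩ := exists_mem_Icc_le_of_integral_le (by linarith) hi (hle.trans hIψ) hP
    refine ⟨t, ht, hPt, ?_, by linarith⟩
    have hv := hKv (u t)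
    have : K * ψ (u t) ≤ K * (7 * δ) := mul_le_mul_of_nonneg_left (by linarith) hK.le
    linarith

lemma continuousOn_and_sub_eq_of_primitive {f g : ℝ → ℝ} {T : ℝ} (hT : 0 ≤ T)
    (hg : IntervalIntegrable g volume 0 T)
    (h : ∀ t ∈ Icc 0 T, f t = f 0 + ∫ s in (0:ℝ)..t, g s) :
    ContinuousOn f (Icc 0 T) ∧
      ∀ s ∈ Icc 0 T, ∀ t ∈ Icc 0 T, f t - f s = ∫ r in s..t, g r := by
  have hsub : ∀ t ∈ Icc 0 T, IntervalIntegrable g volume 0 t := fun t ht =>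
    hg.mono_set (by rw [uIcc_of_le ht.1, uIcc_of_le hT]; exact Icc_subset_Icc_right ht.2)
  constructor
  · have hc := intervalIntegral.continuousOn_primitive_interval (a := 0) (b := T) (f := g)
      (μ := volume) (by
        rw [uIcc_of_le hT]; exact (intervalIntegrable_iff_integrableOn_Icc_of_le hT).1 hg)
    rw [uIcc_of_le hT] at hc
    exact (continuousOn_const.add hc).congr h
  · intro s hs t ht
    rw [h t ht, h s hs, add_sub_add_left_eq_sub,
      intervalIntegral.integral_interval_sub_left (hsub t ht) (hsub s hs)]

lemma rho_le_and_le_cos_of_window {φ ψ θ κ u p₃ p₄ : ℝ → ℝ} {ρ φh α a ε : ℝ} (hρ : 0 < ρ)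
    (hε : 0 < ε) (hε1 : ε ≤ 1 / 1000)
    (hκ : ContinuousOn κ (Icc a (a + 1))) (hφ : Continuous (deriv φ))
    (hθ : ContinuousOn θ (Icc a (a + 1))) (hp₃ : ContinuousOn p₃ (Icc a (a + 1)))
    (hp₃' : ∀ s ∈ Icc a (a + 1), ∀ t ∈ Icc a (a + 1),
      p₃ t - p₃ s = ∫ r in s..t, ρ * Real.sin (θ r - φh))
    (hp₄' : ∀ s ∈ Icc a (a + 1), ∀ t ∈ Icc a (a + 1),
      p₄ t - p₄ s = ∫ r in s..t, (-(p₃ r) + deriv φ (κ r)))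
    (hsmall : ∀ t ∈ Icc a (a + 1), |κ t| ≤ ε ∧ |φ (κ t)| ≤ ε ∧ |deriv φ (κ t)| ≤ ε ∧
      |Real.sin (θ t - φh) - Real.sin (α - φh)| ≤ ε ∧
      |Real.cos (θ t - φh) - Real.cos (α - φh)| ≤ ε)
    (hgood : ∀ c d, a ≤ c → d = c + 1 / 7 → d ≤ a + 1 → ∃ t ∈ Icc c d,
      (ρ * Real.cos (θ t - φh) + p₃ t * κ t + p₄ t * u t - (1 + φ (κ t) + ψ (u t)) = 0) ∧
      |u t| ≤ ε ∧ |ψ (u t)| ≤ ε ∧ |p₄ t| ≤ ε) :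
    ρ ≤ 1 + 444 * ε ∧ 1 - 677 * ε ≤ Real.cos (α - φh) := by
  set S := Real.sin (α - φh)
  set c := Real.cos (α - φh)
  have key : ∀ t₁ ∈ Icc a (a + 1), ∀ t₂ ∈ Icc a (a + 1), 1 / 7 ≤ t₂ - t₁ → |p₄ t₁| ≤ ε →
      |p₄ t₂| ≤ ε → ∃ s ∈ Icc t₁ t₂, |p₃ s| ≤ 15 * ε := by
    intro t₁ ht₁ t₂ ht₂ h12 h1 h2
    have hlt : t₁ < t₂ := by linarith
    have hsub : Icc t₁ t₂ ⊆ Icc a (a + 1) := Icc_subset_Icc ht₁.1 ht₂.2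
    obtain ⟨s, hs, hav⟩ := exists_eq_interval_average (f := p₃) hlt.ne
      (by rw [uIcc_of_le hlt.le]; exact hp₃.mono hsub)
    rw [uIoo_of_le hlt.le] at hs
    refine ⟨s, Ioo_subset_Icc_self hs, ?_⟩
    rw [interval_average_eq_div, eq_div_iff (by linarith)] at hav
    have hi3 : IntervalIntegrable (fun t => p₃ t) volume t₁ t₂ :=
      (hp₃.mono hsub).intervalIntegrable_of_Icc hlt.le
    have hiφ : IntervalIntegrable (fun t => deriv φ (κ t)) volume t₁ t₂ :=
      (hφ.comp_continuousOn (hκ.mono hsub)).intervalIntegrable_of_Icc hlt.le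
    have h4 := hp₄' t₁ ht₁ t₂ ht₂
    rw [intervalIntegral.integral_add (f := fun t => -p₃ t) hi3.neg hiφ, intervalIntegral.integral_neg, ← hav] at h4
    have hb := intervalIntegral.norm_integral_le_of_norm_le_const (a := t₁) (b := t₂)
      (f := fun t => deriv φ (κ t)) (C := ε) fun r hr => by
        rw [uIoc_of_le hlt.le] at hr
        exact (hsmall r (hsub (Ioc_subset_Icc_self hr))).2.2.1
    rw [Real.norm_eq_abs, abs_of_pos (by linarith : 0 < t₂ - t₁)] at hb
    have hprod : |p₃ s| * (t₂ - t₁) ≤ 2 * ε + ε * (t₂ - t₁) := by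
      rw [← abs_of_pos (by linarith : 0 < t₂ - t₁), ← abs_mul,
        abs_of_pos (by linarith : 0 < t₂ - t₁)]
      rw [abs_le] at h1 h2 hb ⊢
      constructor <;> linarith [h1.1, h1.2, h2.1, h2.2, hb.1, hb.2]
    nlinarith [abs_nonneg (p₃ s)]
  have hvar : ∀ s ∈ Icc a (a + 1), ∀ t ∈ Icc a (a + 1), s ≤ t →
      |p₃ t - p₃ s - (t - s) * (ρ * S)| ≤ ρ * ε * (t - s) := by
    intro s hs t ht hst
    have hsub : Icc s t ⊆ Icc a (a + 1) := Icc_subset_Icc hs.1 ht.2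
    have hi : IntervalIntegrable (fun r => ρ * Real.sin (θ r - φh)) volume s t :=
      (continuousOn_const.mul (Real.continuous_sin.comp_continuousOn
        ((hθ.mono hsub).sub continuousOn_const))).intervalIntegrable_of_Icc hst
    have hb := intervalIntegral.norm_integral_le_of_norm_le_const (a := s) (b := t)
      (f := fun r => ρ * Real.sin (θ r - φh) - ρ * S) (C := ρ * ε) fun r hr => by
        rw [uIoc_of_le hst] at hr
        rw [← mul_sub, Real.norm_eq_abs, abs_mul, abs_of_pos hρ]
        exact mul_le_mul_of_nonneg_left
          (hsmall r (hsub (Ioc_subset_Icc_self hr))).2.2.2.1 hρ.le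
    rw [intervalIntegral.integral_sub hi intervalIntegrable_const,
      intervalIntegral.integral_const, smul_eq_mul, ← hp₃' s hs t ht, Real.norm_eq_abs,
      abs_of_nonneg (sub_nonneg.2 hst)] at hb
    exact hb
  obtain ⟨t₁, ht₁, hH, hu₁, hψ₁, hq₁⟩ := hgood a (a + 1 / 7) le_rfl rfl (by linarith)
  obtain ⟨t₂, ht₂, -, -, -, hq₂⟩ :=
    hgood (a + 2 / 7) (a + 3 / 7) (by linarith) (by ring) (by linarith)
  obtain ⟨t₃, ht₃, -, -, -, hq₃⟩ :=
    hgood (a + 4 / 7) (a + 5 / 7) (by linarith) (by ring) (by linarith)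
  obtain ⟨t₄, ht₄, -, -, -, hq₄⟩ :=
    hgood (a + 6 / 7) (a + 1) (by linarith) (by ring) le_rfl
  have m₁ : t₁ ∈ Icc a (a + 1) := ⟨ht₁.1, by linarith [ht₁.2]⟩
  have m₂ : t₂ ∈ Icc a (a + 1) := ⟨by linarith [ht₂.1], by linarith [ht₂.2]⟩
  have m₃ : t₃ ∈ Icc a (a + 1) := ⟨by linarith [ht₃.1], by linarith [ht₃.2]⟩
  have m₄ : t₄ ∈ Icc a (a + 1) := ⟨by linarith [ht₄.1], ht₄.2⟩
  obtain ⟨s₁, hs₁, hps₁⟩ := key t₁ m₁ t₂ m₂ (by linarith [ht₁.2, ht₂.1]) hq₁ hq₂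
  obtain ⟨s₂, hs₂, hps₂⟩ := key t₃ m₃ t₄ m₄ (by linarith [ht₃.2, ht₄.1]) hq₃ hq₄
  have n₁ : s₁ ∈ Icc a (a + 1) := ⟨m₁.1.trans hs₁.1, hs₁.2.trans m₂.2⟩
  have n₂ : s₂ ∈ Icc a (a + 1) := ⟨m₃.1.trans hs₂.1, hs₂.2.trans m₄.2⟩
  have h12 : 1 / 7 ≤ s₂ - s₁ := by linarith [hs₁.2, ht₂.2, ht₃.1, hs₂.1]
  have hρε : 0 < ρ * ε := mul_pos hρ hε
  have hρS : |ρ * S| ≤ 210 * ε + ρ * ε := by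
    have hv := hvar s₁ n₁ s₂ n₂ (by linarith)
    have h3 : (s₂ - s₁) * |ρ * S| ≤ 30 * ε + ρ * ε * (s₂ - s₁) := by
      rw [← abs_of_pos (by linarith : 0 < s₂ - s₁), ← abs_mul,
        abs_of_pos (by linarith : 0 < s₂ - s₁)]
      rw [abs_le] at hps₁ hps₂ hv ⊢
      constructor <;> linarith [hps₁.1, hps₁.2, hps₂.1, hps₂.2, hv.1, hv.2]
    nlinarith
  have hp₃t : |p₃ t₁| ≤ 225 * ε + 2 * (ρ * ε) := by
    have hv := hvar t₁ m₁ s₁ n₁ hs₁.1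
    have hlen : s₁ - t₁ ≤ 1 := by linarith [n₁.2, m₁.1]
    have hlen0 : 0 ≤ s₁ - t₁ := sub_nonneg.2 hs₁.1
    have h3 : |(s₁ - t₁) * (ρ * S)| ≤ 1 * (210 * ε + ρ * ε) := by
      rw [abs_mul, abs_of_nonneg hlen0]
      exact mul_le_mul hlen hρS (abs_nonneg _) zero_le_one
    have h4 : ρ * ε * (s₁ - t₁) ≤ ρ * ε * 1 := mul_le_mul_of_nonneg_left hlen hρε.le
    rw [abs_le] at hv h3 hps₁ ⊢
    constructor <;> linarith [hv.1, hv.2, h3.1, h3.2, hps₁.1, hps₁.2]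
  obtain ⟨hκ₁, hφ₁, -, -, hc₁⟩ := hsmall t₁ m₁
  have hρc : |ρ * c - 1| ≤ 228 * ε + 3 * (ρ * ε) := by
    have e1 : |p₃ t₁ * κ t₁| ≤ (225 * ε + 2 * (ρ * ε)) * 1 := by
      rw [abs_mul]
      exact mul_le_mul hp₃t (by linarith) (abs_nonneg _) (by positivity)
    have e2 : |p₄ t₁ * u t₁| ≤ ε * 1 := by
      rw [abs_mul]
      exact mul_le_mul hq₁ (by linarith) (abs_nonneg _) hε.le
    have e3 : |ρ * (Real.cos (θ t₁ - φh) - c)| ≤ ρ * ε := by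
      rw [abs_mul, abs_of_pos hρ]
      exact mul_le_mul_of_nonneg_left hc₁ hρ.le
    rw [abs_le] at e1 e2 e3 hφ₁ hψ₁ ⊢
    constructor <;>
      linarith [e1.1, e1.2, e2.1, e2.2, e3.1, e3.2, hφ₁.1, hφ₁.2, hψ₁.1, hψ₁.2]
  have hSc : 1 ≤ |S| + |c| := by
    have h := Real.sin_sq_add_cos_sq (α - φh)
    have hS1 := Real.abs_sin_le_one (α - φh)
    have hc1 := Real.abs_cos_le_one (α - φh)
    rw [← sq_abs, ← sq_abs (Real.cos _)] at h
    nlinarith [abs_nonneg S, abs_nonneg c]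
  have hρle : ρ ≤ 1 + 438 * ε + 4 * (ρ * ε) := by
    have e1 : |ρ * c| ≤ 1 + (228 * ε + 3 * (ρ * ε)) := by
      rw [abs_le] at hρc ⊢
      constructor <;> linarith [hρc.1, hρc.2]
    rw [abs_mul, abs_of_pos hρ] at e1 hρS
    nlinarith
  have hρ2 : ρ ≤ 3 / 2 := by nlinarith
  have hρε2 : ρ * ε ≤ 3 / 2 * ε := mul_le_mul_of_nonneg_right hρ2 hε.le
  have hρ3 : ρ ≤ 1 + 444 * ε := by linarith
  refine ⟨hρ3, ?_⟩
  have hcl : 1 - 233 * ε ≤ ρ * c := by linarith [(abs_le.1 hρc).1]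
  have hc0 : 0 < c := by
    by_contra! hneg
    nlinarith
  by_contra! hlt
  nlinarith

lemma deriv_eq_zero_of_nonneg {f : ℝ → ℝ} (h : ∀ r, 0 ≤ f r) (h0 : f 0 = 0) : deriv f 0 = 0 :=
  IsLocalMin.deriv_eq_zero (Filter.Eventually.of_forall fun s => by rw [h0]; exact h s)

lemma exists_pos_forall_abs_le {f : ℝ → ℝ} (hf : Continuous f) (h0 : f 0 = 0) {ε : ℝ}
    (hε : 0 < ε) : ∃ δ > 0, ∀ x, |x| ≤ δ → |f x| ≤ ε := by
  obtain ⟨δ, hδ, h⟩ := Metric.continuousAt_iff.1 (hf.continuousAt (x := (0 : ℝ))) ε hε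
  refine ⟨δ / 2, by positivity, fun x hx => ?_⟩
  have := h (x := x) (by rw [Real.dist_eq, sub_zero]; linarith)
  rw [Real.dist_eq, h0, sub_zero] at this
  exact this.le

lemma exists_unit_window {f : ℝ → ℝ} {T C δ : ℝ} {N : ℕ} (hf0 : ∀ t, 0 ≤ f t)
    (hf : IntervalIntegrable f volume 0 T) (hC : ∫ t in (0:ℝ)..T, f t ≤ C) (hN : 0 < N)
    (hNT : (N : ℝ) ≤ T) (hCN : C ≤ N * δ) :
    ∃ a, 0 ≤ a ∧ a + 1 ≤ T ∧ ∫ t in a..(a + 1), f t ≤ δ := by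
  have hsum : ∑ j ∈ Finset.range N, ∫ t in (j : ℝ)..((j + 1 : ℕ) : ℝ), f t
      = ∫ t in ((0 : ℕ) : ℝ)..(N : ℝ), f t := by
    refine intervalIntegral.sum_integral_adjacent_intervals (a := fun j : ℕ => (j : ℝ))
      fun j hj => (integral_le_integral_of_subinterval (by positivity) (by simp) ?_ hf0 hf).1
    exact le_trans (by exact_mod_cast hj) hNT
  have hle : ∑ j ∈ Finset.range N, ∫ t in (j : ℝ)..((j + 1 : ℕ) : ℝ), f t
      ≤ ∑ j ∈ Finset.range N, δ := by
    rw [hsum, Finset.sum_const, Finset.card_range, nsmul_eq_mul]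
    have := (integral_le_integral_of_subinterval (c := ((0 : ℕ) : ℝ)) (d := N) (by simp)
      (by simp) hNT hf0 hf).2
    linarith
  obtain ⟨j, hj, hjδ⟩ := Finset.exists_le_of_sum_le (by simpa using hN.ne') hle
  refine ⟨j, by positivity, ?_, ?_⟩
  · have : j + 1 ≤ N := Finset.mem_range.1 hj
    exact le_trans (by exact_mod_cast this) hNT
  · simpa using hjδ

/-- `|φ̂ - α| ≤ η` and `ρ ≤ 1 + η` for optimal trajectories with
target far enough from the origin. -/
theorem phase_and_rho_asymptotics
    (φ ψ : ℝ → ℝ) (p C₀ R₀ : ℝ)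
    (h1 : H1 φ ψ) (h2 : H2 ψ) (h3 : H3 ψ p C₀ R₀)
    (η : ℝ) (hη : 0 < η) :
    ∃ R > (0:ℝ),
      ∀ (x₁ y₁ θ₁ α : ℝ), α ∈ Set.Ico 0 (2*π) →
        x₁ = Real.sqrt (x₁^2 + y₁^2) * Real.cos α →
        y₁ = Real.sqrt (x₁^2 + y₁^2) * Real.sin α →
        R ≤ Real.sqrt (x₁^2 + y₁^2) →
      ∀ (x y θ κ u : ℝ → ℝ) (T ρ φh : ℝ) (p₃ p₄ : ℝ → ℝ),
        IsOptimal φ ψ p x y θ κ u T Xinit (x₁, y₁, θ₁, 0) →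
        PMPData φ ψ θ κ u T ρ φh p₃ p₄ →
        angleDist φh α ≤ η ∧ ρ ≤ 1 + η := by
  have hp : 1 < p := h3.1
  obtain ⟨C, hC⟩ := exists_competitor h1 hp
  have h1' := h1
  obtain ⟨hφ0, hψ0, hφc, hψc, hφe, hψe, hφm, hψm, hφz, hψz⟩ := h1'
  have hφ' : Continuous (deriv φ) := hφc.continuous_deriv (by norm_num)
  have hψ' : Continuous (deriv ψ) := hψc.continuous_deriv (by norm_num)
  have hm0 : 0 < min η π := lt_min hη pi_pos
  have hcos1 : Real.cos (min η π) < 1 := by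
    rw [← Real.cos_zero]
    exact Real.cos_lt_cos_of_nonneg_of_le_pi le_rfl (min_le_right _ _) hm0
  set ε := min (1 / 1000) (min (η / 444) ((1 - Real.cos (min η π)) / 677)) with hεdef
  have hε : 0 < ε :=
    lt_min (by norm_num) (lt_min (by positivity) (div_pos (by linarith) (by norm_num)))
  have hε1 : ε ≤ 1 / 1000 := min_le_left _ _
  have hεη : 444 * ε ≤ η := by
    have : ε ≤ η / 444 := (min_le_right _ _).trans (min_le_left _ _)
    linarith
  have hεc : 677 * ε ≤ 1 - Real.cos (min η π) := by
    have : ε ≤ (1 - Real.cos (min η π)) / 677 := (min_le_right _ _).trans (min_le_right _ _)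
    linarith
  obtain ⟨e₁, he₁, hs₁⟩ := exists_pos_forall_abs_le hφc.continuous hφz hε
  obtain ⟨e₂, he₂, hs₂⟩ :=
    exists_pos_forall_abs_le hφ' (deriv_eq_zero_of_nonneg hφ0 hφz) hε
  obtain ⟨e₃, he₃, hs₃⟩ :=
    exists_pos_forall_abs_le hψ' (deriv_eq_zero_of_nonneg hψ0 hψz) hε
  set ε' := min ε (min e₁ (min e₂ e₃)) with hε'def
  have hε'0 : 0 < ε' := by positivity
  have l0 : ε' ≤ ε := min_le_left _ _
  have l1 : ε' ≤ e₁ := (min_le_right _ _).trans (min_le_left _ _)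
  have l2 : ε' ≤ e₂ := (min_le_right _ _).trans ((min_le_right _ _).trans (min_le_left _ _))
  have l3 : ε' ≤ e₃ := (min_le_right _ _).trans ((min_le_right _ _).trans (min_le_right _ _))
  obtain ⟨δ, hδ, hwin⟩ := exists_window_estimates h1 h2 hε'0 (by linarith)
  set N : ℕ := ⌈C / δ⌉₊ + 1 with hN
  have hCN : C ≤ N * δ := by
    rw [← div_le_iff₀ hδ, hN]
    push_cast
    linarith [Nat.le_ceil (C / δ)]
  refine ⟨max 8 N, by positivity, ?_⟩
  intro x₁ y₁ θ₁ α hα hx₁ hy₁ hR x y θ κ u T ρ φh p₃ p₄ hopt hpmp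
  set r := Real.sqrt (x₁ ^ 2 + y₁ ^ 2) with hr
  have hr8 : 8 ≤ r := (le_max_left _ _).trans hR
  have hrN : (N : ℝ) ≤ r := (le_max_right _ _).trans hR
  obtain ⟨hconn, hmin⟩ := hopt
  obtain ⟨x', y', θ', κ', u', T', hconn', hcost'⟩ := hC r hr8 α hα θ₁
  rw [← hx₁, ← hy₁] at hconn'
  have hcost : cost φ ψ κ u T ≤ r + C := (hmin _ _ _ _ _ _ hconn').trans hcost'
  obtain ⟨hT, humeas, hup, hx0, hy0, hθ0, hκ0, hx, hy, hθ, hκ, hxT, hyT, -, -⟩ := hconn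
  obtain ⟨hρ, hφh, hp₃, hp₄, hψu, hH⟩ := hpmp
  have hu : IntervalIntegrable u volume 0 T :=
    (intervalIntegrable_iff_integrableOn_Icc_of_le hT.le).2
      (abs_rpow_integrableOn_imp hp humeas hup)
  obtain ⟨hκc, hκd⟩ := continuousOn_and_sub_eq_of_primitive hT.le hu hκ
  obtain ⟨hθc, hθd⟩ :=
    continuousOn_and_sub_eq_of_primitive hT.le (hκc.intervalIntegrable_of_Icc hT.le) hθ
  have hcosc : ∀ b, ContinuousOn (fun t => Real.cos (θ t - b)) (Icc 0 T) := fun b =>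
    Real.continuous_cos.comp_continuousOn (hθc.sub continuousOn_const)
  have hsinc : ContinuousOn (fun t => ρ * Real.sin (θ t - φh)) (Icc 0 T) :=
    continuousOn_const.mul (Real.continuous_sin.comp_continuousOn (hθc.sub continuousOn_const))
  obtain ⟨hp₃c, hp₃d⟩ :=
    continuousOn_and_sub_eq_of_primitive hT.le (hsinc.intervalIntegrable_of_Icc hT.le) hp₃
  have hp₄i : ContinuousOn (fun s => -(p₃ s) + deriv φ (κ s)) (Icc 0 T) :=
    hp₃c.neg.add (hφ'.comp_continuousOn hκc)
  obtain ⟨hp₄c, hp₄d⟩ :=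
    continuousOn_and_sub_eq_of_primitive hT.le (hp₄i.intervalIntegrable_of_Icc hT.le) hp₄
  have hφκ : ContinuousOn (fun t => φ (κ t)) (Icc 0 T) := hφc.continuous.comp_continuousOn hκc
  have hψint : IntervalIntegrable (fun t => ψ (u t)) volume 0 T := by
    rw [intervalIntegrable_iff_integrableOn_Icc_of_le hT.le]
    have hc : ContinuousOn (fun t => ρ * Real.cos (θ t - φh) + p₃ t * κ t - (1 + φ (κ t)))
        (Icc 0 T) :=
      ((continuousOn_const.mul (hcosc φh)).add (hp₃c.mul hκc)).sub (continuousOn_const.add hφκ)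
    have hpu : IntegrableOn (fun t => p₄ t * u t) (Icc 0 T) :=
      ((intervalIntegrable_iff_integrableOn_Icc_of_le hT.le).1 hu).continuousOn_mul hp₄c
        isCompact_Icc
    refine (hc.integrableOn_Icc.add hpu).congr ?_
    filter_upwards [hH] with t ht
    simp only [Pi.add_apply]
    linarith
  have hφint : IntervalIntegrable (fun t => φ (κ t)) volume 0 T :=
    hφκ.intervalIntegrable_of_Icc hT.le
  have hcosint : ∫ t in (0:ℝ)..T, Real.cos (θ t - α) = r := by
    have hci : IntervalIntegrable (fun t => Real.cos (θ t)) volume 0 T :=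
      (Real.continuous_cos.comp_continuousOn hθc).intervalIntegrable_of_Icc hT.le
    have hsi : IntervalIntegrable (fun t => Real.sin (θ t)) volume 0 T :=
      (Real.continuous_sin.comp_continuousOn hθc).intervalIntegrable_of_Icc hT.le
    have hX := hx T ⟨hT.le, le_rfl⟩
    have hY := hy T ⟨hT.le, le_rfl⟩
    rw [hxT, hx0] at hX
    rw [hyT, hy0] at hY
    simp only [Xinit, zero_add] at hX hY
    simp only [Real.cos_sub]
    rw [intervalIntegral.integral_add (hci.mul_const _) (hsi.mul_const _),
      intervalIntegral.integral_mul_const, intervalIntegral.integral_mul_const, ← hX, ← hY]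
    calc x₁ * Real.cos α + y₁ * Real.sin α
        = (r * Real.cos α) * Real.cos α + (r * Real.sin α) * Real.sin α := by rw [← hx₁, ← hy₁]
      _ = r * (Real.sin α ^ 2 + Real.cos α ^ 2) := by ring
      _ = r := by rw [Real.sin_sq_add_cos_sq, mul_one]
  have hcosi : IntervalIntegrable (fun t => Real.cos (θ t - α)) volume 0 T :=
    (hcosc α).intervalIntegrable_of_Icc hT.le
  have hrT : r ≤ T := by
    rw [← hcosint]
    have := intervalIntegral.integral_mono_on hT.le hcosi
      (intervalIntegrable_const (c := (1 : ℝ))) fun t _ => Real.cos_le_one (θ t - α)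
    simpa using this
  have hci : IntervalIntegrable (fun t => 1 + φ (κ t) + ψ (u t)) volume 0 T :=
    (intervalIntegrable_const.add hφint).add hψint
  have hexc : (fun t => 1 - Real.cos (θ t - α) + φ (κ t) + ψ (u t)) =
      fun t => (1 + φ (κ t) + ψ (u t)) - Real.cos (θ t - α) := by
    funext t; ring
  have hei : IntervalIntegrable (fun t => 1 - Real.cos (θ t - α) + φ (κ t) + ψ (u t))
      volume 0 T := by
    rw [hexc]; exact hci.sub hcosi
  have heC : ∫ t in (0:ℝ)..T, (1 - Real.cos (θ t - α) + φ (κ t) + ψ (u t)) ≤ C := by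
    rw [hexc, intervalIntegral.integral_sub hci hcosi, hcosint]
    unfold cost at hcost
    linarith
  obtain ⟨a, ha0, haT, haδ⟩ := exists_unit_window
    (fun t => by linarith [Real.cos_le_one (θ t - α), hφ0 (κ t), hψ0 (u t)]) hei heC
    (Nat.succ_pos _) (hrN.trans hrT) hCN
  have hsub : Icc a (a + 1) ⊆ Icc 0 T := Icc_subset_Icc ha0 haT
  have hsub' : uIcc a (a + 1) ⊆ uIcc 0 T := by
    rwa [uIcc_of_le (by linarith), uIcc_of_le hT.le]
  obtain ⟨hsm, hgd⟩ := hwin θ κ u a α (hu.mono_set hsub') (hκc.mono hsub) (hθc.mono hsub)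
    (fun s hs t ht => hκd s (hsub hs) t (hsub ht)) (fun s hs t ht => hθd s (hsub hs) t (hsub ht))
    (hψint.mono_set hsub') haδ
  obtain ⟨hρle, hcosle⟩ := rho_le_and_le_cos_of_window (φ := φ) (ψ := ψ) (θ := θ) (κ := κ)
    (u := u) (p₃ := p₃) (p₄ := p₄) (φh := φh) (α := α) (a := a) hρ hε hε1 (hκc.mono hsub) hφ'
    (hθc.mono hsub) (hp₃c.mono hsub) (fun s hs t ht => hp₃d s (hsub hs) t (hsub ht))
    (fun s hs t ht => hp₄d s (hsub hs) t (hsub ht))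
    (fun t ht => by
      obtain ⟨hk, hb⟩ := hsm t ht
      exact ⟨hk.trans l0, hs₁ _ (hk.trans l1), hs₂ _ (hk.trans l2), (hb φh).1.trans l0,
        (hb φh).2.trans l0⟩)
    (fun c d hc hd hd1 => by
      have hcd : Icc c d ⊆ Icc 0 T := (Icc_subset_Icc hc hd1).trans hsub
      obtain ⟨t, ht, ⟨hHt, hψt⟩, hut, hψut⟩ := hgd c d hc hd hd1 _
        ((ae_restrict_of_ae_restrict_of_subset hcd hH).and
          (ae_restrict_of_ae_restrict_of_subset hcd hψu))
      refine ⟨t, ht, hHt, hut.trans l0, ?_, ?_⟩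
      · rw [abs_of_nonneg (hψ0 _)]; exact hψut.trans l0
      · rw [← hψt]; exact hs₃ _ (hut.trans l3))
  refine ⟨angleDist_le_of_cos_le hη ?_, by linarith⟩
  rw [← Real.cos_neg (φh - α), neg_sub]
  linarith

end
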